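/- Let Z be a random element of E with E[|e(Z)|] < ∞, and let Y be a random element of E₀ whose distribution satisfies the inversion formula E[h(Y)] = (1/E[|e(Z)|]) · E[Σ_{k∈e(Z)} h(θ_k Z)] for every measurable h : E₀ → [0,∞). Then Y is exceedance-stationary, and Z is a representative of its anchored process, i.e. E[g(Z)] = E[g(Z^A)] for every shift-invariant measurable g : E → [0,∞) and every anchoring function A, where Z^A has law P(Y ∈ · | A(Y) = 0). -/

import Mathlib

open MeasureTheory ENNReal Filter ProbabilityTheory

noncomputable section

/-- The space `ℝ^{ℤ^d}` of real-valued fields indexed by `ℤ^d`. -/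
abbrev RField (d : ℕ) := (Fin d → ℤ) → ℝ

variable {d : ℕ}

/-- Shift operator: `shift k x = (x_{i+k})_i`, i.e. it moves the origin to `k`. -/
def shift (k : Fin d → ℤ) (x : RField d) : RField d := fun i => x (i + k)

/-- The set of exceedance-points of `x`. -/
def excSet (x : RField d) : Set (Fin d → ℤ) := {k | 1 < |x k|}

open Classical in
/-- Indicator (with values in `ℝ≥0∞`) of the event that `|x k| > s`. -/
def exIndGT (s : ℝ) (k : Fin d → ℤ) (x : RField d) : ℝ≥0∞ := if s < |x k| then 1 else 0

/-- The tail-process identity: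
`E[h(θ_k Y) 1{|Y_k| > 1}] = E[h(Y) 1{|Y_{−k}| > 1}]` for every measurable nonnegative `h`
and every `k ∈ ℤ^d`. -/
def TailIdentity {Ω : Type*} [MeasurableSpace Ω] (μ : Measure Ω) (Y : Ω → RField d) : Prop :=
  ∀ h : RField d → ℝ≥0∞, Measurable h → ∀ k : Fin d → ℤ,
    ∫⁻ ω, h (shift k (Y ω)) * exIndGT 1 k (Y ω) ∂μ
      = ∫⁻ ω, h (Y ω) * exIndGT 1 (-k) (Y ω) ∂μ

/-- `Y` is exceedance-stationary: for every exceedance-map `τ` which is bijective on a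
measurable set `B` (invariant under shifting the origin to exceedance-points, contained in
`ℝ₀^{ℤ^d}`) carrying the law of `Y`, we have `θ_τ Y ≐ Y`. -/
def ExcStationary {Ω : Type*} [MeasurableSpace Ω] (μ : Measure Ω) (Y : Ω → RField d) : Prop :=
  ∀ (B : Set (RField d)) (τ : RField d → Fin d → ℤ),
    MeasurableSet B → Measurable τ →
    (∀ x ∈ B, 1 < |x 0|) →
    (∀ x ∈ B, ∀ k ∈ excSet x, shift k x ∈ B) →
    (∀ x ∈ B, τ x ∈ excSet x) →
    (∀ x ∈ B, Set.BijOn (fun k => k + τ (shift k x)) (excSet x) (excSet x)) →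
    (∀ᵐ ω ∂μ, Y ω ∈ B) →
    Measure.map (fun ω => shift (τ (Y ω)) (Y ω)) μ = Measure.map Y μ

/-- `E₀`: elements of `ℝ₀^{ℤ^d}` with finitely many exceedance-points. -/
def E0set (d : ℕ) : Set (RField d) := {x | 1 < |x 0| ∧ (excSet x).Finite}

/-- `E`: elements of `ℝ^{ℤ^d}` with at least one but finitely many exceedance-points. -/
def Eset (d : ℕ) : Set (RField d) := {x | (excSet x).Nonempty ∧ (excSet x).Finite}

/-- `l₀`: fields vanishing at infinity. -/
def l0set (d : ℕ) : Set (RField d) := {x | Tendsto (fun i => |x i|) cofinite (nhds 0)}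

/-- Uniform norm `‖x‖ = sup_i |x_i|`. -/
def supNorm (x : RField d) : ℝ := ⨆ i, |x i|

/-- `V` is Pareto(α)-distributed: `P(V > y) = y^{-α}` for `y ≥ 1`. -/
def IsPareto {Ω : Type*} [MeasurableSpace Ω] (μ : Measure Ω) (V : Ω → ℝ) (α : ℝ) : Prop :=
  ∀ y : ℝ, 1 ≤ y → μ {ω | y < V ω} = ENNReal.ofReal (y ^ (-α))

/-- An anchoring function on `S`: a measurable shift-covariant exceedance-map. -/
def IsAnchoringOn (S : Set (RField d)) (A : RField d → Fin d → ℤ) : Prop :=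
  Measurable A ∧ ∀ x ∈ S, A x ∈ excSet x ∧ ∀ k ∈ excSet x, A (shift k x) + k = A x

/-- `h` is shift-invariant on `S`. -/
def ShiftInvariantOn (S : Set (RField d)) (h : RField d → ℝ≥0∞) : Prop :=
  ∀ x ∈ S, ∀ k : Fin d → ℤ, h (shift k x) = h x

theorem shift_shift (j k : Fin d → ℤ) (x : RField d) :
    shift j (shift k x) = shift (j + k) x := by
  funext i
  simp only [shift, add_assoc]

theorem exIndGT_shift (s : ℝ) (j k : Fin d → ℤ) (x : RField d) :
    exIndGT s j (shift k x) = exIndGT s (j + k) x := rfl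

theorem exIndGT_one_of_mem {k : Fin d → ℤ} {x : RField d} (hk : k ∈ excSet x) :
    exIndGT 1 k x = 1 := if_pos hk

theorem exIndGT_one_of_notMem {k : Fin d → ℤ} {x : RField d} (hk : k ∉ excSet x) :
    exIndGT 1 k x = 0 := if_neg hk

theorem measurable_exIndGT (s : ℝ) (k : Fin d → ℤ) :
    Measurable (exIndGT s k : RField d → ℝ≥0∞) :=
  Measurable.ite (measurableSet_lt measurable_const (measurable_pi_apply k).norm)
    measurable_const measurable_const

theorem measurable_shift (k : Fin d → ℤ) : Measurable (shift k : RField d → RField d) :=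
  measurable_pi_lambda _ fun i => measurable_pi_apply (i + k)

theorem measurable_shift_comp {τ : RField d → Fin d → ℤ} (hτ : Measurable τ) :
    Measurable fun x => shift (τ x) x := by
  have h : Measurable fun p : RField d × (Fin d → ℤ) => shift p.2 p.1 :=
    measurable_from_prod_countable_left fun k => measurable_shift k
  exact h.comp (measurable_id.prodMk hτ)

/-- Summing over exceedance-points does not depend on the choice of the origin. -/
theorem tsum_exIndGT_shift (k : Fin d → ℤ) (x : RField d) (F : RField d → ℝ≥0∞) :
    ∑' j, exIndGT 1 j (shift k x) * F (shift j (shift k x))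
      = ∑' j, exIndGT 1 j x * F (shift j x) := by
  simp only [exIndGT_shift, shift_shift]
  exact (Equiv.addRight k).tsum_eq fun j => exIndGT 1 j x * F (shift j x)

theorem tsum_exIndGT_mul (x : RField d) (F : (Fin d → ℤ) → ℝ≥0∞) :
    ∑' k, exIndGT 1 k x * F k = ∑' k : excSet x, F k := by
  rw [tsum_subtype]
  refine tsum_congr fun k => ?_
  by_cases hk : k ∈ excSet x
  · simp [hk, exIndGT_one_of_mem]
  · simp [hk, exIndGT_one_of_notMem]

/-- A bijective exceedance-shift permutes the terms of a sum over exceedance-points. -/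
theorem tsum_exIndGT_shift_of_bijOn {τ : RField d → Fin d → ℤ} {x : RField d}
    (hb : Set.BijOn (fun k => k + τ (shift k x)) (excSet x) (excSet x))
    (h : RField d → ℝ≥0∞) :
    ∑' k, exIndGT 1 k x * h (shift (τ (shift k x)) (shift k x))
      = ∑' k, exIndGT 1 k x * h (shift k x) := by
  rw [tsum_exIndGT_mul x fun k => h (shift (τ (shift k x)) (shift k x)),
    tsum_exIndGT_mul x fun k => h (shift k x),
    ← hb.equiv.tsum_eq fun k : excSet x => h (shift k x)]
  refine tsum_congr fun k => ?_
  rw [shift_shift, add_comm]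
  rfl

/-- Only the exceedance-point chosen by the anchoring function contributes to the sum. -/
theorem tsum_exIndGT_mul_indicator_anchor {A : RField d → Fin d → ℤ}
    (hA : IsAnchoringOn (Eset d) A) {g : RField d → ℝ≥0∞}
    (hg : ShiftInvariantOn (Eset d) g) {x : RField d} (hx : x ∈ Eset d) :
    ∑' k, exIndGT 1 k x * {y | A y = 0}.indicator g (shift k x) = g x := by
  obtain ⟨hmem, hcov⟩ := hA.2 x hx
  rw [tsum_eq_single (A x)]
  · have h0 : shift (A x) x ∈ {y | A y = 0} := add_eq_right.mp (hcov _ hmem)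
    rw [exIndGT_one_of_mem hmem, Set.indicator_of_mem h0, hg x hx, one_mul]
  · intro k hk
    by_cases hke : k ∈ excSet x
    · have h0 : shift k x ∉ {y | A y = 0} := fun h => hk (by
        have := hcov k hke
        rwa [show A (shift k x) = 0 from h, zero_add] at this)
      rw [Set.indicator_of_notMem h0, mul_zero]
    · rw [exIndGT_one_of_notMem hke, zero_mul]

/-- Let `Z` be a random element of `E` with `E[|e(Z)|] < ∞`, and let `Y`
be a random element of `E₀` whose distribution satisfies the inversion formula
`E[h(Y)] = E[Σ_{k∈e(Z)} h(θ_k Z)] / E[|e(Z)|]` for all measurable `h ≥ 0`. Then `Y` is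
exceedance-stationary and `Z` is a representative of its anchored process. -/
theorem inversion_formula_gives_exceedance_stationary
    {Ω : Type*} [MeasurableSpace Ω] (μ : Measure Ω) [IsProbabilityMeasure μ]
    {Ω₂ : Type*} [MeasurableSpace Ω₂] (μ₂ : Measure Ω₂) [IsProbabilityMeasure μ₂]
    (Z : Ω₂ → RField d) (hZ : Measurable Z) (hZE : ∀ᵐ ω ∂μ₂, Z ω ∈ Eset d)
    (hZfin : ∫⁻ ω, (excSet (Z ω)).encard ∂μ₂ ≠ ⊤)
    (Y : Ω → RField d) (hY : Measurable Y) (hE0 : ∀ᵐ ω ∂μ, Y ω ∈ E0set d)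
    (hInv : ∀ h : RField d → ℝ≥0∞, Measurable h →
      ∫⁻ ω, h (Y ω) ∂μ
        = (∫⁻ ω, (excSet (Z ω)).encard ∂μ₂)⁻¹ *
            ∫⁻ ω, ∑' k : Fin d → ℤ, exIndGT 1 k (Z ω) * h (shift k (Z ω)) ∂μ₂) :
    ExcStationary μ Y ∧
      ∀ A : RField d → Fin d → ℤ, IsAnchoringOn (Eset d) A →
        ∀ g : RField d → ℝ≥0∞, Measurable g → ShiftInvariantOn (Eset d) g →
          ∫⁻ ω, g (Z ω) ∂μ₂
            = ∫⁻ x, g x ∂(ProbabilityTheory.cond (Measure.map Y μ) {x | A x = 0}) := by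
  set c : ℝ≥0∞ := ∫⁻ ω, (excSet (Z ω)).encard ∂μ₂
  have hc0 : c ≠ 0 := by
    have h1 : (1 : ℝ≥0∞) ≤ c := by
      calc (1 : ℝ≥0∞) = ∫⁻ _, 1 ∂μ₂ := by simp
        _ ≤ c := lintegral_mono_ae <| by
          filter_upwards [hZE] with ω hω
          exact_mod_cast Set.one_le_encard_iff_nonempty.mpr hω.1
    exact (zero_lt_one.trans_le h1).ne'
  refine ⟨?_, ?_⟩
  · intro B τ hB hτ _ _ _ hbij hYB
    have hZB : ∀ᵐ ω ∂μ₂, ∀ k ∈ excSet (Z ω), shift k (Z ω) ∈ B := by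
      have hBc : Measurable (Bᶜ.indicator (1 : RField d → ℝ≥0∞)) :=
        measurable_one.indicator hB.compl
      have h0 := hInv _ hBc
      rw [lintegral_congr_ae (g := fun _ => 0) (by
        filter_upwards [hYB] with ω hω
        simp [hω]), lintegral_zero] at h0
      have h1 := (mul_eq_zero.mp h0.symm).resolve_left (ENNReal.inv_ne_zero.mpr hZfin)
      have hm : Measurable fun ω =>
          ∑' k, exIndGT 1 k (Z ω) * Bᶜ.indicator (1 : RField d → ℝ≥0∞) (shift k (Z ω)) :=
        Measurable.tsum fun k => ((measurable_exIndGT 1 k).comp hZ).mul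
          (hBc.comp ((measurable_shift k).comp hZ))
      rw [lintegral_eq_zero_iff hm] at h1
      filter_upwards [h1] with ω hω k hk
      have h2 := ENNReal.tsum_eq_zero.mp hω k
      rw [exIndGT_one_of_mem hk, one_mul] at h2
      by_contra hn
      simp [hn] at h2
    have hτY : Measurable fun ω => shift (τ (Y ω)) (Y ω) := (measurable_shift_comp hτ).comp hY
    have key : ∀ h : RField d → ℝ≥0∞, Measurable h →
        ∫⁻ ω, h (shift (τ (Y ω)) (Y ω)) ∂μ = ∫⁻ ω, h (Y ω) ∂μ := by
      intro h hh
      rw [hInv h hh, hInv (fun x => h (shift (τ x) x)) (hh.comp (measurable_shift_comp hτ))]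
      congr 1
      refine lintegral_congr_ae ?_
      filter_upwards [hZE, hZB] with ω hω hωB
      obtain ⟨k, hk⟩ := hω.1
      rw [← tsum_exIndGT_shift k (Z ω) h,
        ← tsum_exIndGT_shift k (Z ω) fun x => h (shift (τ x) x)]
      exact tsum_exIndGT_shift_of_bijOn (hbij _ (hωB k hk)) h
    refine Measure.ext_of_lintegral _ fun h hh => ?_
    rw [lintegral_map hh hτY, lintegral_map hh hY]
    exact key h hh
  · intro A hA g hg hgs
    have hS : MeasurableSet {x : RField d | A x = 0} := hA.1 (measurableSet_singleton 0)
    have key : ∀ f : RField d → ℝ≥0∞, Measurable f → ShiftInvariantOn (Eset d) f →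
        ∫⁻ x in {x | A x = 0}, f x ∂(Measure.map Y μ) = c⁻¹ * ∫⁻ ω, f (Z ω) ∂μ₂ := by
      intro f hf hfs
      rw [← lintegral_indicator hS, lintegral_map (hf.indicator hS) hY,
        hInv _ (hf.indicator hS)]
      congr 1
      refine lintegral_congr_ae ?_
      filter_upwards [hZE] with ω hω
      exact tsum_exIndGT_mul_indicator_anchor hA hfs hω
    have hP : Measure.map Y μ {x | A x = 0} = c⁻¹ := by
      simpa using key 1 measurable_one fun _ _ _ => rfl
    rw [ProbabilityTheory.cond, lintegral_smul_measure, key g hg hgs, hP, inv_inv,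
      smul_eq_mul, ← mul_assoc, ENNReal.mul_inv_cancel hc0 hZfin, one_mul]
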